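/- arXiv:1205.0380 — 2 statements merged into one kernel-verified Lean document; each statement's English description precedes it below -/
import Mathlib

section
/- (Concentration from Laplace-transform bounds.) Let (X, d) be a metric space equipped with a Borel probability measure ν and let c > 0. Assume that for every bounded function F : X → ℝ that is 1-Lipschitz (LipschitzWith 1) and satisfies ∫ F dν = 0, and for every λ > 0, one has ∫ e^{λF} dν ≤ exp(c·λ²). Then for all nonempty Borel sets A, B ⊆ X one has ν(A)·ν(B) ≤ exp( - dist(A,B)²/(8c) ), where dist(A,B) = inf{ d(a,b) : a ∈ A, b ∈ B }. -/
open MeasureTheory Real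

/-- The set distance `dist(A,B) = inf { dist a b : a ∈ A, b ∈ B }`
(not the Hausdorff distance). -/
noncomputable def setDist {X : Type*} [MetricSpace X] (A B : Set X) : ℝ :=
  sInf {d : ℝ | ∃ a ∈ A, ∃ b ∈ B, d = dist a b}

open ProbabilityTheory in
/-- Chernoff bound with the Laplace transform of a bounded 1-Lipschitz function controlled
by a Gaussian one. -/
lemma measureReal_le_of_laplace_bound {X : Type*} [MetricSpace X] [MeasurableSpace X]
    [BorelSpace X] (ν : Measure X) [IsProbabilityMeasure ν] {c l t : ℝ} (hl : 0 < l)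
    {F : X → ℝ} (hbdd : ∃ M : ℝ, ∀ x, |F x| ≤ M) (hLip : LipschitzWith 1 F)
    (hF : ∫ x, Real.exp (l * F x) ∂ν ≤ Real.exp (c * l ^ 2))
    {S : Set X} (hS : ∀ x ∈ S, t ≤ F x) :
    ν.real S ≤ Real.exp (-l * t + c * l ^ 2) := by
  obtain ⟨M, hM⟩ := hbdd
  have hint : Integrable (fun x => Real.exp (l * F x)) ν := by
    refine Integrable.of_bound (C := Real.exp (l * M))
      (by have := hLip.continuous.measurable; fun_prop) (ae_of_all _ fun x => ?_)
    rw [Real.norm_eq_abs, Real.abs_exp]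
    gcongr
    exact (le_abs_self _).trans (hM x)
  calc ν.real S ≤ ν.real {x | t ≤ F x} := measureReal_mono hS
    _ ≤ Real.exp (-l * t) * mgf F ν l := measure_ge_le_exp_mul_mgf t hl.le hint
    _ ≤ Real.exp (-l * t) * Real.exp (c * l ^ 2) := by gcongr; exact hF
    _ = _ := (Real.exp_add _ _).symm

lemma setDist_nonneg {X : Type*} [MetricSpace X] (A B : Set X) : 0 ≤ setDist A B := by
  apply Real.sInf_nonneg
  rintro _ ⟨a, -, b, -, rfl⟩
  exact dist_nonneg

lemma setDist_le_dist {X : Type*} [MetricSpace X] {A B : Set X} {a b : X} (ha : a ∈ A)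
    (hb : b ∈ B) : setDist A B ≤ dist a b := by
  refine csInf_le ⟨0, ?_⟩ ⟨a, ha, b, hb, rfl⟩
  rintro _ ⟨a, -, b, -, rfl⟩
  exact dist_nonneg

/-- Concentration from Laplace-transform bounds (second step of the Herbst argument in
the proof of Theorem 1.7 of Hein–Naber): a uniform bound `∫ e^{λF} dν ≤ exp(c·λ²)` for
all bounded 1-Lipschitz mean-zero `F` implies Gaussian concentration. -/
theorem concentration_of_laplace_bounds {X : Type*} [MetricSpace X] [MeasurableSpace X]
    [BorelSpace X] (ν : Measure X) [IsProbabilityMeasure ν] (c : ℝ) (hc : 0 < c)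
    (hlap : ∀ F : X → ℝ, (∃ M : ℝ, ∀ x, |F x| ≤ M) → LipschitzWith 1 F →
      (∫ x, F x ∂ν = 0) →
      ∀ l : ℝ, 0 < l → ∫ x, Real.exp (l * F x) ∂ν ≤ Real.exp (c * l ^ 2))
    (A B : Set X) (hA : MeasurableSet A) (hB : MeasurableSet B)
    (hAne : A.Nonempty) (hBne : B.Nonempty) :
    ν A * ν B ≤ ENNReal.ofReal (Real.exp (-(setDist A B) ^ 2 / (8 * c))) := by
  rcases (setDist_nonneg A B).eq_or_lt with h0 | hD
  · rw [← h0]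
    simpa using mul_le_one' (prob_le_one (μ := ν) (s := A)) (prob_le_one (μ := ν) (s := B))
  set D := setDist A B
  set G : X → ℝ := fun x => min (Metric.infDist x B) D
  have hG0 : ∀ x, 0 ≤ G x := fun x => le_min Metric.infDist_nonneg hD.le
  have hGD : ∀ x, G x ≤ D := fun x => min_le_right _ _
  have hGL : LipschitzWith 1 G := (Metric.lipschitz_infDist_pt B).min_const D
  have hGA : ∀ x ∈ A, G x = D := fun x hx =>
    min_eq_right ((Metric.le_infDist hBne).2 fun y hy => setDist_le_dist hx hy)
  have hGB : ∀ x ∈ B, G x = 0 := fun x hx => by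
    simp [G, Metric.infDist_zero_of_mem hx, hD.le]
  have hGi : Integrable G ν :=
    Integrable.of_bound (C := D) hGL.continuous.measurable.aestronglyMeasurable
      (ae_of_all _ fun x => by rw [Real.norm_eq_abs, abs_of_nonneg (hG0 x)]; exact hGD x)
  set m := ∫ x, G x ∂ν
  have hmean : ∫ x, (G x - m) ∂ν = 0 := by
    rw [integral_sub hGi (integrable_const m)]
    simp [m]
  have hmean' : ∫ x, -(G x - m) ∂ν = 0 := by rw [integral_neg, hmean, neg_zero]
  have hLip : LipschitzWith 1 (fun x => G x - m) :=
    LipschitzWith.of_dist_le_mul fun x y => by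
      simpa [Real.dist_eq] using hGL.dist_le_mul x y
  have hLip' : LipschitzWith 1 (fun x => -(G x - m)) := hLip.neg
  have hbdd : ∀ x, |G x - m| ≤ D + |m| := fun x =>
    (abs_sub _ _).trans (by rw [abs_of_nonneg (hG0 x)]; linarith [hGD x])
  have hbdd' : ∀ x, |-(G x - m)| ≤ D + |m| := fun x => by rw [abs_neg]; exact hbdd x
  have hl : 0 < D / (4 * c) := by positivity
  have hνA := measureReal_le_of_laplace_bound ν hl ⟨_, hbdd⟩ hLip
    (hlap _ ⟨_, hbdd⟩ hLip hmean _ hl) (S := A) (t := D - m) fun x hx => by rw [hGA x hx]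
  have hνB := measureReal_le_of_laplace_bound ν hl ⟨_, hbdd'⟩ hLip'
    (hlap _ ⟨_, hbdd'⟩ hLip' hmean' _ hl) (S := B) (t := m) fun x hx => by
      rw [hGB x hx]; simp
  rw [← ofReal_measureReal (μ := ν) (s := A), ← ofReal_measureReal (μ := ν) (s := B),
    ← ENNReal.ofReal_mul measureReal_nonneg]
  apply ENNReal.ofReal_le_ofReal
  refine (mul_le_mul hνA hνB measureReal_nonneg (Real.exp_nonneg _)).trans_eq ?_
  rw [← Real.exp_add]
  congr 1
  field_simp
  ring
end

section
/- (Gradient identity with Hessian remainder along the heat semigroup.) Let n ≥ 1, let u : ℝⁿ → ℝ be smooth and compactly supported, let t > 0 and x₀ ∈ ℝⁿ. Then P_t(‖∇u‖²)(x₀) - ‖∇(P_t u)(x₀)‖² = 2·∫₀ᵗ P_{t-r}( Σ_{i,j=1}^{n} (∂_i ∂_j (P_r u))² )(x₀) dr, where ∂_i denotes the partial derivative in the i-th coordinate direction of an orthonormal basis. In particular ‖∇(P_t u)(x₀)‖² ≤ P_t(‖∇u‖²)(x₀). -/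
open MeasureTheory Real

/-- The Euclidean heat semigroup on `ℝⁿ`: `(P_t f)(x) = ∫ f(y)·k_t(x,y) dy` for `t > 0`,
with heat kernel `k_t(x,y) = (4πt)^{-n/2}·exp(-‖x-y‖²/(4t))`, and `P_0 f = f`. -/
noncomputable def heatSemigroup (n : ℕ) (t : ℝ) (f : EuclideanSpace ℝ (Fin n) → ℝ)
    (x : EuclideanSpace ℝ (Fin n)) : ℝ :=
  if t = 0 then f x
  else ∫ y, f y * ((4 * π * t) ^ (-(n : ℝ) / 2) * Real.exp (-‖x - y‖ ^ 2 / (4 * t)))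

/-- The squared Frobenius norm of the Hessian `Σ_{i,j} (∂_i ∂_j v)²` of a function on
`ℝⁿ`, with `∂_i` the partial derivative in the `i`-th coordinate direction. -/
noncomputable def hessianSq (n : ℕ) (v : EuclideanSpace ℝ (Fin n) → ℝ)
    (y : EuclideanSpace ℝ (Fin n)) : ℝ :=
  ∑ i : Fin n, ∑ j : Fin n,
    (fderiv ℝ (fun z => fderiv ℝ v z (EuclideanSpace.single j 1)) y
      (EuclideanSpace.single i 1)) ^ 2

open scoped FourierTransform

/-- The heat kernel integrates plane waves to damped plane waves. -/
theorem integral_planeWave_mul_heatKernel {n : ℕ} {s : ℝ} (hs : 0 < s)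
    (w x : EuclideanSpace ℝ (Fin n)) :
    ∫ y, Complex.exp (Complex.I * (inner ℝ w y : ℝ)) *
        (((4 * π * s) ^ (-(n : ℝ) / 2) * Real.exp (-‖x - y‖ ^ 2 / (4 * s)) : ℝ) : ℂ) =
      Complex.exp (-(s * ‖w‖ ^ 2 : ℝ)) * Complex.exp (Complex.I * (inner ℝ w x : ℝ)) := by
  have hs' : (s : ℂ) ≠ 0 := by exact_mod_cast hs.ne'
  have h4 : 0 < 4 * π * s := by positivity
  have hb : 0 < ((1 / (4 * s) : ℝ) : ℂ).re := by
    rw [Complex.ofReal_re]; positivity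
  have key := GaussianFourier.integral_cexp_neg_mul_sq_norm_add hb Complex.I w
  rw [← integral_add_left_eq_self _ x]
  have hpt : ∀ v : EuclideanSpace ℝ (Fin n),
      Complex.exp (Complex.I * (inner ℝ w (x + v) : ℝ)) *
        (((4 * π * s) ^ (-(n : ℝ) / 2) * Real.exp (-‖x - (x + v)‖ ^ 2 / (4 * s)) : ℝ) : ℂ) =
      (((4 * π * s) ^ (-(n : ℝ) / 2) : ℝ) * Complex.exp (Complex.I * (inner ℝ w x : ℝ))) *
        Complex.exp (-((1 / (4 * s) : ℝ) : ℂ) * ‖v‖ ^ 2 + Complex.I * (inner ℝ w v : ℝ)) := by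
    intro v
    rw [show x - (x + v) = -v by abel, norm_neg, inner_add_right]
    push_cast
    rw [mul_add, Complex.exp_add, Complex.exp_add,
      show -(‖v‖ : ℂ) ^ 2 / (4 * s) = -(1 / (4 * s)) * ‖v‖ ^ 2 by ring]
    ring
  simp_rw [hpt]
  rw [integral_const_mul, key, finrank_euclideanSpace_fin]
  have hpi : (π : ℂ) / ((1 / (4 * s) : ℝ) : ℂ) = ((4 * π * s : ℝ) : ℂ) := by
    push_cast
    field_simp
  have hpow : ((4 * π * s : ℝ) : ℂ) ^ ((n : ℂ) / 2) = (((4 * π * s) ^ ((n : ℝ) / 2) : ℝ) : ℂ) := by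
    rw [Complex.ofReal_cpow h4.le]
    push_cast
    rfl
  have hone : (((4 * π * s) ^ (-(n : ℝ) / 2) : ℝ) : ℂ) *
      (((4 * π * s) ^ ((n : ℝ) / 2) : ℝ) : ℂ) = 1 := by
    rw [← Complex.ofReal_mul, ← Real.rpow_add h4]
    norm_num [neg_div]
  have hexp : Complex.I ^ 2 * (‖w‖ : ℂ) ^ 2 / (4 * ((1 / (4 * s) : ℝ) : ℂ)) =
      -((s * ‖w‖ ^ 2 : ℝ) : ℂ) := by
    rw [Complex.I_sq]
    push_cast
    field_simp
  rw [hpi, hpow, hexp]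
  linear_combination Complex.exp (Complex.I * (inner ℝ w x : ℝ)) *
    Complex.exp (-((s * ‖w‖ ^ 2 : ℝ) : ℂ)) * hone

theorem integrable_heatKernel {n : ℕ} {s : ℝ} (hs : 0 < s) (x : EuclideanSpace ℝ (Fin n)) :
    Integrable fun y : EuclideanSpace ℝ (Fin n) =>
      (4 * π * s) ^ (-(n : ℝ) / 2) * Real.exp (-‖x - y‖ ^ 2 / (4 * s)) := by
  have hb : 0 < ((1 / (4 * s) : ℝ) : ℂ).re := by
    rw [Complex.ofReal_re]; positivity
  have key := (GaussianFourier.integrable_cexp_neg_mul_sq_norm_add hb 0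
    (0 : EuclideanSpace ℝ (Fin n))).norm.comp_sub_left x
  refine (key.congr (.of_forall fun y => ?_)).const_mul _
  simp only [Complex.norm_exp]
  congr 1
  rw [zero_mul, add_zero, ← Complex.ofReal_pow, ← Complex.ofReal_neg, ← Complex.ofReal_mul,
    Complex.ofReal_re]
  ring

theorem norm_exp_I_mul_ofReal (θ : ℝ) : ‖Complex.exp (Complex.I * θ)‖ = 1 := by
  rw [mul_comm, Complex.norm_exp_ofReal_mul_I]

theorem sum_inner_single_mul_inner_single {n : ℕ} (v w : EuclideanSpace ℝ (Fin n)) :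
    ∑ i, inner ℝ v (EuclideanSpace.single i 1) * inner ℝ w (EuclideanSpace.single i 1) =
      (inner ℝ v w : ℝ) := by
  simp [PiLp.inner_apply, mul_comm]

theorem norm_gradient_sq_eq_sum {n : ℕ} (f : EuclideanSpace ℝ (Fin n) → ℝ)
    (x : EuclideanSpace ℝ (Fin n)) :
    ‖gradient f x‖ ^ 2 = ∑ i, fderiv ℝ f x (EuclideanSpace.single i 1) ^ 2 := by
  rw [EuclideanSpace.real_norm_sq_eq]
  refine Finset.sum_congr rfl fun i _ => ?_
  rw [← toDual_gradient, InnerProductSpace.toDual_apply_apply, EuclideanSpace.inner_single_right]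
  simp

/-- `f` is the superposition of the plane waves `x ↦ exp (i⟪ξ a, x⟫)` with integrable
amplitude `g`. -/
structure IsPlaneWaveSuperposition {n : ℕ} {α : Type*} [MeasurableSpace α] (μ : Measure α)
    (ξ : α → EuclideanSpace ℝ (Fin n)) (g : α → ℂ) (f : EuclideanSpace ℝ (Fin n) → ℝ) :
    Prop where
  measurable : Measurable ξ
  integrable : Integrable g μ
  eq_integral (x : EuclideanSpace ℝ (Fin n)) :
    (f x : ℂ) = ∫ a, g a * Complex.exp (Complex.I * (inner ℝ (ξ a) x : ℝ)) ∂μ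

namespace IsPlaneWaveSuperposition

variable {n : ℕ} {α β : Type*} [MeasurableSpace α] [MeasurableSpace β] {μ : Measure α}
  {ν : Measure β} {ξ : α → EuclideanSpace ℝ (Fin n)} {η : β → EuclideanSpace ℝ (Fin n)}
  {g : α → ℂ} {h : β → ℂ} {f k : EuclideanSpace ℝ (Fin n) → ℝ}

theorem integrable_mul_exp (hf : IsPlaneWaveSuperposition μ ξ g f)
    (x : EuclideanSpace ℝ (Fin n)) :
    Integrable (fun a => g a * Complex.exp (Complex.I * (inner ℝ (ξ a) x : ℝ))) μ := by
  have hξ := hf.measurable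
  refine hf.integrable.mul_bdd (c := 1) (Measurable.aestronglyMeasurable (by fun_prop))
    (.of_forall fun a => (norm_exp_I_mul_ofReal _).le)

theorem congr_amplitude {g' : α → ℂ} (hf : IsPlaneWaveSuperposition μ ξ g f)
    (hg : ∀ a, g a = g' a) : IsPlaneWaveSuperposition μ ξ g' f :=
  (funext hg : g = g') ▸ hf

theorem congr_fun {f' : EuclideanSpace ℝ (Fin n) → ℝ} (hf : IsPlaneWaveSuperposition μ ξ g f)
    (h : ∀ x, f x = f' x) : IsPlaneWaveSuperposition μ ξ g f' :=
  (funext h : f = f') ▸ hf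

protected theorem sum {ι : Type*} (s : Finset ι) {G : ι → α → ℂ}
    {F : ι → EuclideanSpace ℝ (Fin n) → ℝ} (hξ : Measurable ξ)
    (hF : ∀ i ∈ s, IsPlaneWaveSuperposition μ ξ (G i) (F i)) :
    IsPlaneWaveSuperposition μ ξ (fun a => ∑ i ∈ s, G i a) (fun x => ∑ i ∈ s, F i x) where
  measurable := hξ
  integrable := integrable_finsetSum s fun i hi => (hF i hi).integrable
  eq_integral x := by
    simp_rw [Finset.sum_mul]
    rw [integral_finsetSum s fun i hi => (hF i hi).integrable_mul_exp x, Complex.ofReal_sum]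
    exact Finset.sum_congr rfl fun i hi => (hF i hi).eq_integral x

protected theorem mul [SFinite μ] [SFinite ν] (hf : IsPlaneWaveSuperposition μ ξ g f)
    (hk : IsPlaneWaveSuperposition ν η h k) :
    IsPlaneWaveSuperposition (μ.prod ν) (fun p => ξ p.1 + η p.2) (fun p => g p.1 * h p.2)
      (fun x => f x * k x) where
  measurable := (hf.measurable.comp measurable_fst).add (hk.measurable.comp measurable_snd)
  integrable := hf.integrable.mul_prod hk.integrable
  eq_integral x := by
    rw [Complex.ofReal_mul, hf.eq_integral, hk.eq_integral, ← integral_prod_mul]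
    refine integral_congr_ae (.of_forall fun p => ?_)
    simp only [inner_add_left, Complex.ofReal_add, mul_add, Complex.exp_add]
    ring

theorem integrable_exp_mul {s : ℝ} (hs : 0 ≤ s) (hξ : Measurable ξ) (hg : Integrable g μ) :
    Integrable (fun a => Complex.exp (-(s * ‖ξ a‖ ^ 2 : ℝ)) * g a) μ := by
  refine hg.bdd_mul (c := 1) (Measurable.aestronglyMeasurable (by fun_prop))
    (.of_forall fun a => ?_)
  rw [← Complex.ofReal_neg, Complex.norm_exp_ofReal, Real.exp_le_one_iff]
  nlinarith [sq_nonneg ‖ξ a‖]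

theorem integrable_pow_mul_exp_mul {s : ℝ} (hs : 0 ≤ s) (hξ : Measurable ξ) {m : ℕ}
    (hm : Integrable (fun a => (‖ξ a‖ : ℂ) ^ m * g a) μ) :
    Integrable (fun a => (‖ξ a‖ : ℂ) ^ m * (Complex.exp (-(s * ‖ξ a‖ ^ 2 : ℝ)) * g a)) μ :=
  (integrable_exp_mul hs hξ hm).congr (.of_forall fun a => by ring)

protected theorem heatSemigroup [SFinite μ] (hf : IsPlaneWaveSuperposition μ ξ g f) {s : ℝ}
    (hs : 0 ≤ s) :
    IsPlaneWaveSuperposition μ ξ (fun a => Complex.exp (-(s * ‖ξ a‖ ^ 2 : ℝ)) * g a)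
      (heatSemigroup n s f) where
  measurable := hf.measurable
  integrable := integrable_exp_mul hs hf.measurable hf.integrable
  eq_integral x := by
    rcases hs.eq_or_lt with rfl | hs
    · simpa [heatSemigroup] using hf.eq_integral x
    rw [heatSemigroup, if_neg hs.ne', ← integral_complex_ofReal]
    simp_rw [Complex.ofReal_mul (f _), hf.eq_integral, ← integral_mul_const]
    rw [integral_integral_swap]
    · refine integral_congr_ae (.of_forall fun a => ?_)
      simp only
      simp_rw [mul_assoc (g a)]
      rw [integral_const_mul, integral_planeWave_mul_heatKernel hs]
      ring
    · have hξ := hf.measurable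
      have := ((integrable_heatKernel hs x).ofReal (𝕜 := ℂ)).mul_prod hf.integrable
      refine (this.bdd_mul (c := 1)
        (f := fun p => Complex.exp (Complex.I * (inner ℝ (ξ p.2) p.1 : ℝ)))
        (Measurable.aestronglyMeasurable (by fun_prop))
        (.of_forall fun p => (norm_exp_I_mul_ofReal _).le)).congr (.of_forall fun p => ?_)
      simp only [Function.uncurry, RCLike.ofReal_eq_complex_ofReal]
      ring

protected theorem fderiv (hf : IsPlaneWaveSuperposition μ ξ g f)
    (hg : Integrable (fun a => (‖ξ a‖ : ℂ) ^ 1 * g a) μ) (v : EuclideanSpace ℝ (Fin n)) :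
    IsPlaneWaveSuperposition μ ξ (fun a => Complex.I * (inner ℝ (ξ a) v : ℝ) * g a)
      (fun x => fderiv ℝ f x v) := by
  have hξ := hf.measurable
  have hgm := hf.integrable.aestronglyMeasurable
  have hint : Integrable (fun a => ‖ξ a‖ * ‖g a‖) μ := by
    simpa using hg.norm
  let F' (x : EuclideanSpace ℝ (Fin n)) (a : α) : EuclideanSpace ℝ (Fin n) →L[ℝ] ℂ :=
    (g a * Complex.exp (Complex.I * (inner ℝ (ξ a) x : ℝ)) * Complex.I) •
      (Complex.ofRealCLM.comp (innerSL ℝ (ξ a)))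
  have hF'norm : ∀ x a, ‖F' x a‖ ≤ ‖ξ a‖ * ‖g a‖ := by
    intro x a
    rw [norm_smul, norm_mul, norm_mul, norm_exp_I_mul_ofReal, Complex.norm_I, mul_one, mul_one,
      mul_comm]
    gcongr
    refine (ContinuousLinearMap.opNorm_comp_le _ _).trans ?_
    simp
  have hF'meas : ∀ x, AEStronglyMeasurable (F' x) μ := by
    intro x
    have hcont : Continuous fun w : EuclideanSpace ℝ (Fin n) =>
        Complex.ofRealCLM.comp (innerSL ℝ w) := by fun_prop
    have hL : AEStronglyMeasurable
        (fun a => Complex.ofRealCLM.comp (innerSL ℝ (ξ a))) μ :=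
      (hcont.measurable.comp hξ).aestronglyMeasurable
    have hc : AEStronglyMeasurable
        (fun a => g a * Complex.exp (Complex.I * (inner ℝ (ξ a) x : ℝ)) * Complex.I) μ :=
      (hf.integrable_mul_exp x).aestronglyMeasurable.mul_const _
    exact hc.smul hL
  have hF'int : ∀ x, Integrable (F' x) μ := fun x =>
    hint.mono' (hF'meas x) (.of_forall (hF'norm x))
  have hderiv : ∀ x, HasFDerivAt (fun x => (f x : ℂ)) (∫ a, F' x a ∂μ) x := by
    intro x
    simp_rw [hf.eq_integral]
    refine hasFDerivAt_integral_of_dominated_of_fderiv_le (bound := fun a => ‖ξ a‖ * ‖g a‖)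
      Filter.univ_mem (.of_forall fun y => (hf.integrable_mul_exp y).aestronglyMeasurable)
      (hf.integrable_mul_exp x) (hF'meas x) (.of_forall fun a y _ => hF'norm y a) hint
      (.of_forall fun a y _ => ?_)
    have h1 : HasFDerivAt (fun y => ((inner ℝ (ξ a) y : ℝ) : ℂ))
        (Complex.ofRealCLM.comp (innerSL ℝ (ξ a))) y :=
      (Complex.ofRealCLM.comp (innerSL ℝ (ξ a))).hasFDerivAt
    convert! ((h1.const_mul Complex.I).cexp).const_mul (g a) using 1
    simp only [F', smul_smul, mul_assoc]
  refine ⟨hξ, ?_, fun x => ?_⟩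
  · refine (hint.mul_const ‖v‖).mono' ?_ (.of_forall fun a => ?_)
    · exact (Measurable.aestronglyMeasurable (by fun_prop)).mul hgm
    · rw [norm_mul, norm_mul, Complex.norm_I, one_mul, Complex.norm_real, mul_right_comm]
      gcongr
      exact norm_inner_le_norm _ _
  · have hre : HasFDerivAt f (Complex.reCLM.comp (∫ a, F' x a ∂μ)) x :=
      Complex.reCLM.hasFDerivAt.comp x (hderiv x)
    have hof := (Complex.ofRealCLM.hasFDerivAt.comp x hre).unique (hderiv x)
    have := congrArg (fun L => L v) hof
    rw [hre.fderiv]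
    refine this.trans ?_
    rw [ContinuousLinearMap.integral_apply (hF'int x)]
    refine integral_congr_ae (.of_forall fun a => ?_)
    simp [F']
    ring

protected theorem norm_gradient_sq [SFinite μ] (hf : IsPlaneWaveSuperposition μ ξ g f)
    (hg : Integrable (fun a => (‖ξ a‖ : ℂ) ^ 1 * g a) μ) :
    IsPlaneWaveSuperposition (μ.prod μ) (fun p => ξ p.1 + ξ p.2)
      (fun p => -(inner ℝ (ξ p.1) (ξ p.2) : ℝ) * (g p.1 * g p.2))
      (fun x => ‖gradient f x‖ ^ 2) := by
  have key := IsPlaneWaveSuperposition.sum Finset.univ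
    (((hf.fderiv hg 0).mul (hf.fderiv hg 0)).measurable) fun i _ =>
      (hf.fderiv hg (EuclideanSpace.single i 1)).mul (hf.fderiv hg (EuclideanSpace.single i 1))
  refine (key.congr_amplitude fun p => ?_).congr_fun fun x => ?_
  · rw [← sum_inner_single_mul_inner_single, Complex.ofReal_sum, ← Finset.sum_neg_distrib,
      Finset.sum_mul]
    refine Finset.sum_congr rfl fun i _ => ?_
    rw [Complex.ofReal_mul]
    linear_combination (inner ℝ (ξ p.1) (EuclideanSpace.single i 1) : ℂ) *
      (inner ℝ (ξ p.2) (EuclideanSpace.single i 1) : ℝ) * g p.1 * g p.2 * Complex.I_sq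
  · simp_rw [norm_gradient_sq_eq_sum, sq]

protected theorem hessianSq [SFinite μ] (hf : IsPlaneWaveSuperposition μ ξ g f)
    (hg₁ : Integrable (fun a => (‖ξ a‖ : ℂ) ^ 1 * g a) μ)
    (hg₂ : Integrable (fun a => (‖ξ a‖ : ℂ) ^ 2 * g a) μ) :
    IsPlaneWaveSuperposition (μ.prod μ) (fun p => ξ p.1 + ξ p.2)
      (fun p => (inner ℝ (ξ p.1) (ξ p.2) : ℝ) ^ 2 * (g p.1 * g p.2)) (hessianSq n f) := by
  have hξ := hf.measurable
  have hd : ∀ v : EuclideanSpace ℝ (Fin n), Integrable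
      (fun a => (‖ξ a‖ : ℂ) ^ 1 * (Complex.I * (inner ℝ (ξ a) v : ℝ) * g a)) μ := by
    intro v
    refine (hg₂.norm.mul_const ‖v‖).mono' ?_ (.of_forall fun a => ?_)
    · exact (Measurable.aestronglyMeasurable (by fun_prop)).mul
        ((Measurable.aestronglyMeasurable (by fun_prop)).mul hf.integrable.aestronglyMeasurable)
    · simp only [norm_mul, norm_pow, Complex.norm_I, Complex.norm_real, norm_norm, one_mul]
      have := mul_le_mul_of_nonneg_left (norm_inner_le_norm (𝕜 := ℝ) (ξ a) v)
        (mul_nonneg (norm_nonneg (ξ a)) (norm_nonneg (g a)))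
      linarith
  have hD : ∀ i j : Fin n, _ := fun i j =>
    (hf.fderiv hg₁ (EuclideanSpace.single j 1)).fderiv (hd _) (EuclideanSpace.single i 1)
  have hm : Measurable fun p : α × α => ξ p.1 + ξ p.2 := by fun_prop
  have key := IsPlaneWaveSuperposition.sum Finset.univ hm fun i _ =>
    IsPlaneWaveSuperposition.sum Finset.univ hm fun j _ => (hD i j).mul (hD i j)
  refine (key.congr_amplitude fun p => ?_).congr_fun fun x => ?_
  · rw [sq, ← Complex.ofReal_mul]
    nth_rewrite 1 [← sum_inner_single_mul_inner_single]
    rw [← sum_inner_single_mul_inner_single, Finset.sum_mul_sum, Complex.ofReal_sum,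
      Finset.sum_mul]
    refine Finset.sum_congr rfl fun i _ => ?_
    rw [Complex.ofReal_sum, Finset.sum_mul]
    refine Finset.sum_congr rfl fun j _ => ?_
    push_cast
    ring_nf
    simp [show Complex.I ^ 4 = 1 from Complex.I_pow_four]
  · simp_rw [hessianSq, sq]

end IsPlaneWaveSuperposition

/-- Fourier inversion with angular frequencies. -/
theorem SchwartzMap.isPlaneWaveSuperposition_fourier {n : ℕ} {u : EuclideanSpace ℝ (Fin n) → ℝ}
    (φ : SchwartzMap (EuclideanSpace ℝ (Fin n)) ℂ) (hφ : ∀ x, φ x = u x) :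
    IsPlaneWaveSuperposition volume (fun a => (2 * π) • a)
      (⇑(𝓕 φ : SchwartzMap (EuclideanSpace ℝ (Fin n)) ℂ)) u where
  measurable := by fun_prop
  integrable := (𝓕 φ).integrable
  eq_integral x := by
    have hinv : 𝓕⁻ (𝓕 φ : SchwartzMap (EuclideanSpace ℝ (Fin n)) ℂ) = φ :=
      FourierTransform.fourierInv_fourier_eq φ
    rw [← hφ, ← DFunLike.congr_fun hinv x, SchwartzMap.fourierInv_coe, Real.fourierInv_eq']
    refine integral_congr_ae (.of_forall fun a => ?_)
    simp only [smul_eq_mul, inner_smul_left, mul_comm]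
    simp

theorem SchwartzMap.integrable_norm_smul_pow_mul {n : ℕ}
    (φ : SchwartzMap (EuclideanSpace ℝ (Fin n)) ℂ) (c : ℝ) (m : ℕ) :
    Integrable fun a => (‖c • a‖ : ℂ) ^ m * φ a := by
  refine ((φ.integrable_pow_mul volume m).const_mul (|c| ^ m)).mono' ?_ (.of_forall fun a => ?_)
  · exact Continuous.aestronglyMeasurable (by fun_prop)
  · simp [norm_smul, mul_pow, mul_assoc]

theorem two_mul_integral_mul_exp (P q t : ℝ) :
    2 * ∫ r in (0 : ℝ)..t, Complex.exp (-((t - r) * (P + 2 * q) + r * P : ℝ)) * (q : ℂ) ^ 2 =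
      q * (Complex.exp (-(t * P : ℝ)) - Complex.exp (-(t * (P + 2 * q) : ℝ))) := by
  have hderiv : ∀ r ∈ Set.uIcc 0 t, HasDerivAt
      (fun r : ℝ => Complex.exp (-((t - r) * (P + 2 * q) + r * P : ℝ)) * (q / 2 : ℂ))
      (Complex.exp (-((t - r) * (P + 2 * q) + r * P : ℝ)) * (q : ℂ) ^ 2) r := by
    intro r _
    have h1 : HasDerivAt (fun r : ℝ => -((t - r) * (P + 2 * q) + r * P)) (2 * q) r := by
      have := ((((hasDerivAt_id r).const_sub t).mul_const (P + 2 * q)).add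
        ((hasDerivAt_id r).mul_const P)).neg
      convert! this using 1
      ring
    have h2 := (h1.ofReal_comp.cexp).mul_const (q / 2 : ℂ)
    simp only [Complex.ofReal_neg] at h2
    convert! h2 using 1
    push_cast
    ring
  rw [intervalIntegral.integral_eq_sub_of_hasDerivAt hderiv
    (Continuous.intervalIntegrable (by fun_prop) _ _)]
  simp only [sub_self, zero_mul, zero_add, sub_zero, add_zero]
  ring

theorem heatSemigroup_nonneg {n : ℕ} {s : ℝ} (hs : 0 ≤ s) {f : EuclideanSpace ℝ (Fin n) → ℝ}
    (hf : ∀ y, 0 ≤ f y) (x : EuclideanSpace ℝ (Fin n)) : 0 ≤ heatSemigroup n s f x := by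
  unfold heatSemigroup
  split_ifs
  · exact hf x
  · exact integral_nonneg fun y => mul_nonneg (hf y) (by positivity)

theorem hessianSq_nonneg (n : ℕ) (v : EuclideanSpace ℝ (Fin n) → ℝ)
    (y : EuclideanSpace ℝ (Fin n)) : 0 ≤ hessianSq n v y :=
  Finset.sum_nonneg fun _ _ => Finset.sum_nonneg fun _ _ => sq_nonneg _

namespace IsPlaneWaveSuperposition

variable {n : ℕ} {α : Type*} [MeasurableSpace α] {μ : Measure α}
  {ξ : α → EuclideanSpace ℝ (Fin n)} {g : α → ℂ} {f : EuclideanSpace ℝ (Fin n) → ℝ}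

theorem heatSemigroup_norm_gradient_sq_sub [SFinite μ] (hf : IsPlaneWaveSuperposition μ ξ g f)
    (hg₁ : Integrable (fun a => (‖ξ a‖ : ℂ) ^ 1 * g a) μ)
    (hg₂ : Integrable (fun a => (‖ξ a‖ : ℂ) ^ 2 * g a) μ) {t : ℝ} (ht : 0 ≤ t)
    (x : EuclideanSpace ℝ (Fin n)) :
    heatSemigroup n t (fun y => ‖gradient f y‖ ^ 2) x - ‖gradient (heatSemigroup n t f) x‖ ^ 2 =
      2 * ∫ r in (0 : ℝ)..t, heatSemigroup n (t - r) (hessianSq n (heatSemigroup n r f)) x := by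
  have hξ := hf.measurable
  let q : α × α → ℝ := fun p => inner ℝ (ξ p.1) (ξ p.2)
  let P : α × α → ℝ := fun p => ‖ξ p.1‖ ^ 2 + ‖ξ p.2‖ ^ 2
  have hPq : ∀ p, ‖ξ p.1 + ξ p.2‖ ^ 2 = P p + 2 * q p := fun p => by
    rw [norm_add_sq_real]; simp only [P, q]; ring
  let W : α × α → ℂ := fun p =>
    g p.1 * g p.2 * Complex.exp (Complex.I * (inner ℝ (ξ p.1 + ξ p.2) x : ℝ))
  let Φ : ℝ → α × α → ℂ := fun r p =>
    Complex.exp (-((t - r) * (P p + 2 * q p) + r * P p : ℝ)) * (q p : ℂ) ^ 2 * W p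
  have hA := (hf.norm_gradient_sq hg₁).heatSemigroup ht
  have hB := (hf.heatSemigroup ht).norm_gradient_sq (integrable_pow_mul_exp_mul ht hξ hg₁)
  have hRep : ∀ r ∈ Set.Icc 0 t,
      ((heatSemigroup n (t - r) (hessianSq n (heatSemigroup n r f)) x : ℝ) : ℂ) =
        ∫ p, Φ r p ∂(μ.prod μ) := by
    intro r hr
    have h := ((hf.heatSemigroup hr.1).hessianSq (integrable_pow_mul_exp_mul hr.1 hξ hg₁)
      (integrable_pow_mul_exp_mul hr.1 hξ hg₂)).heatSemigroup (sub_nonneg.2 hr.2)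
    rw [h.eq_integral]
    refine integral_congr_ae (.of_forall fun p => ?_)
    simp only [Φ, W, hPq]
    rw [show -(((t - r) * (P p + 2 * q p) + r * P p : ℝ) : ℂ) =
      -(((t - r) * (P p + 2 * q p) : ℝ) : ℂ) + -((r * ‖ξ p.1‖ ^ 2 : ℝ) : ℂ) +
        -((r * ‖ξ p.2‖ ^ 2 : ℝ) : ℂ) by simp only [P]; push_cast; ring,
      Complex.exp_add, Complex.exp_add]
    ring
  have hqW : Integrable (fun p => (q p : ℂ) ^ 2 * W p) (μ.prod μ) := by
    refine (((hf.hessianSq hg₁ hg₂).integrable_mul_exp x)).congr (.of_forall fun p => ?_)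
    simp only [q, W]
    ring
  have hΦ : Integrable (Function.uncurry Φ)
      ((volume.restrict (Set.uIoc 0 t)).prod (μ.prod μ)) := by
    have : IsFiniteMeasure (volume.restrict (Set.uIoc (0 : ℝ) t)) :=
      ⟨by simp [Set.uIoc_of_le ht]⟩
    have h1 := hqW.comp_snd (volume.restrict (Set.uIoc (0 : ℝ) t))
    refine (h1.bdd_mul (c := 1) (f := fun z : ℝ × α × α =>
      Complex.exp (-((t - z.1) * (P z.2 + 2 * q z.2) + z.1 * P z.2 : ℝ)))
      (Measurable.aestronglyMeasurable (by fun_prop)) ?_).congr (.of_forall fun z => ?_)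
    · have hz : ∀ᵐ z ∂((volume.restrict (Set.uIoc 0 t)).prod (μ.prod μ)), z.1 ∈ Set.uIoc 0 t :=
        Measure.quasiMeasurePreserving_fst.ae (ae_restrict_mem measurableSet_uIoc)
      filter_upwards [hz] with z hz
      rw [Set.uIoc_of_le ht] at hz
      rw [← Complex.ofReal_neg, Complex.norm_exp_ofReal, Real.exp_le_one_iff, ← hPq,
        neg_nonpos]
      have := sub_nonneg.2 hz.2
      have := hz.1
      positivity
    · simp only [Function.uncurry, Φ]
      ring
  apply Complex.ofReal_injective
  rw [Complex.ofReal_sub, hA.eq_integral, hB.eq_integral, ← integral_sub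
    (hA.integrable_mul_exp x) (hB.integrable_mul_exp x), Complex.ofReal_mul,
    ← intervalIntegral.integral_ofReal, intervalIntegral.integral_congr
      (g := fun r => ∫ p, Φ r p ∂(μ.prod μ)) fun r hr => hRep r (Set.uIcc_of_le ht ▸ hr),
    intervalIntegral_integral_swap hΦ, Complex.ofReal_ofNat, ← integral_const_mul]
  refine integral_congr_ae (.of_forall fun p => ?_)
  simp only [Φ]
  rw [intervalIntegral.integral_mul_const, ← mul_assoc (2 : ℂ), two_mul_integral_mul_exp, hPq]
  rw [show -((t * P p : ℝ) : ℂ) = -((t * ‖ξ p.1‖ ^ 2 : ℝ) : ℂ) + -((t * ‖ξ p.2‖ ^ 2 : ℝ) : ℂ) by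
      simp only [P]; push_cast; ring, Complex.exp_add]
  simp only [W, q]
  ring

end IsPlaneWaveSuperposition

/-- Gradient identity with Hessian remainder along the heat semigroup: the flat-space
case of identity (3.10) of Hein–Naber, obtained from the parabolic Bochner formula and
the homotopy principle. In particular `‖∇(P_t u)(x₀)‖² ≤ P_t(‖∇u‖²)(x₀)`. -/
theorem gradient_identity_heatSemigroup (n : ℕ) (hn : 1 ≤ n)
    (u : EuclideanSpace ℝ (Fin n) → ℝ) (hu : ContDiff ℝ (⊤ : ℕ∞) u)
    (hsupp : HasCompactSupport u) (t : ℝ) (ht : 0 < t)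
    (x₀ : EuclideanSpace ℝ (Fin n)) :
    (heatSemigroup n t (fun y => ‖gradient u y‖ ^ 2) x₀ -
        ‖gradient (heatSemigroup n t u) x₀‖ ^ 2 =
      2 * ∫ r in (0:ℝ)..t,
        heatSemigroup n (t - r) (hessianSq n (heatSemigroup n r u)) x₀) ∧
    ‖gradient (heatSemigroup n t u) x₀‖ ^ 2 ≤
      heatSemigroup n t (fun y => ‖gradient u y‖ ^ 2) x₀ := by
  let φ : SchwartzMap (EuclideanSpace ℝ (Fin n)) ℂ :=
    (hsupp.comp_left (g := Complex.ofReal) Complex.ofReal_zero).toSchwartzMap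
      (Complex.ofRealCLM.contDiff.comp hu)
  have hrep := φ.isPlaneWaveSuperposition_fourier (u := u) fun _ => rfl
  have hid := hrep.heatSemigroup_norm_gradient_sq_sub
    ((𝓕 φ).integrable_norm_smul_pow_mul _ 1) ((𝓕 φ).integrable_norm_smul_pow_mul _ 2) ht.le x₀
  refine ⟨hid, sub_nonneg.1 (hid ▸ mul_nonneg zero_le_two ?_)⟩
  exact intervalIntegral.integral_nonneg ht.le fun r hr =>
    heatSemigroup_nonneg (sub_nonneg.2 hr.2) (hessianSq_nonneg n _) x₀
end
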